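/- arXiv:alg-geom/9709002 — 3 statements merged into one kernel-verified Lean document; each statement's English description precedes it below -/
import Mathlib

section
/- Let H and W be finite-dimensional real vector spaces, and let B be a symmetric bilinear form on W such that every subspace of W on which B is positive definite has dimension at most 1. Let φ : H × H → W be an alternating bilinear map, and let T : H × H × H × H → ℝ be an alternating multilinear form such that B(φ(a,b), φ(c,d)) = T(a,b,c,d) for all a, b, c, d ∈ H. Then T = 0. -/
/-- The span of two nonzero orthogonal vectors of positive square contradicts the bound `1` on the
dimension of positive definite subspaces. -/
theorem not_pos_of_orthogonal_of_pos {W : Type*} [AddCommGroup W] [Module ℝ W]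
    (B : W →ₗ[ℝ] W →ₗ[ℝ] ℝ)
    (hBpos : ∀ U : Submodule ℝ W, (∀ u ∈ U, u ≠ 0 → 0 < B u u) → Module.finrank ℝ U ≤ 1)
    {u v : W} (hu : 0 < B u u) (huv : B u v = 0) (hvu : B v u = 0) : ¬ 0 < B v v := by
  intro hv
  have hli : LinearIndependent ℝ ![u, v] := by
    rw [LinearIndependent.pair_iff]
    intro s t h
    have h₁ := congrArg (B u) h
    have h₂ := congrArg (B v) h
    simp only [map_add, map_smul, smul_eq_mul, huv, hvu, map_zero, mul_zero, add_zero,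
      zero_add, mul_eq_zero, hu.ne', hv.ne', or_false] at h₁ h₂
    exact ⟨h₁, h₂⟩
  have hle := hBpos (Submodule.span ℝ (Set.range ![u, v])) fun w hw hw0 => by
    rw [Matrix.range_cons_cons_empty, Submodule.mem_span_pair] at hw
    obtain ⟨s, t, rfl⟩ := hw
    have key : B (s • u + t • v) (s • u + t • v) = s ^ 2 * B u u + t ^ 2 * B v v := by
      simp only [map_add, map_smul, LinearMap.add_apply, LinearMap.smul_apply, smul_eq_mul,
        huv, hvu]
      ring
    rw [key]
    rcases eq_or_ne s 0 with rfl | hs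
    · have ht : t ≠ 0 := by
        rintro rfl
        simp at hw0
      positivity
    · positivity
  rw [finrank_span_eq_card hli, Fintype.card_fin] at hle
  omega

/-- For a closed 4-manifold with `b⁺ = 1` (abstracted: `B` is a symmetric bilinear
form on `W` whose positive definite subspaces have dimension at most 1), an
alternating bilinear map `φ : H × H → W` and an alternating 4-form `T` with
`B (φ a b) (φ c d) = T a b c d` force `T = 0`. -/
theorem quadruple_product_vanishes
    {H W : Type*} [AddCommGroup H] [Module ℝ H] [FiniteDimensional ℝ H]
    [AddCommGroup W] [Module ℝ W] [FiniteDimensional ℝ W]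
    (B : W →ₗ[ℝ] W →ₗ[ℝ] ℝ) (hBsymm : ∀ x y, B x y = B y x)
    (hBpos : ∀ U : Submodule ℝ W, (∀ u ∈ U, u ≠ 0 → 0 < B u u) →
      Module.finrank ℝ U ≤ 1)
    (φ : H →ₗ[ℝ] H →ₗ[ℝ] W) (hφ : ∀ a, φ a a = 0)
    (T : H [⋀^Fin 4]→ₗ[ℝ] ℝ)
    (hT : ∀ a b c d : H, B (φ a b) (φ c d) = T ![a, b, c, d]) :
    T = 0 := by
  ext v
  obtain ⟨a, b, c, d, rfl⟩ : ∃ a b c d, v = ![a, b, c, d] :=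
    ⟨v 0, v 1, v 2, v 3, by ext i; fin_cases i <;> rfl⟩
  rw [AlternatingMap.zero_apply, ← hT]
  by_contra ht
  have hswap : ∀ x y, φ x y = -φ y x := fun x y => by
    have h := hφ (x + y)
    simp only [map_add, LinearMap.add_apply, hφ, zero_add, add_zero] at h
    exact eq_neg_of_add_eq_zero_right h
  have h₀₂ : ∀ x y z, B (φ x y) (φ x z) = 0 := fun x y z => by
    rw [hT]
    exact T.map_eq_zero_of_eq _ (i := 0) (j := 2) rfl (by decide)
  have h₀₃ : ∀ x y z, B (φ x y) (φ z x) = 0 := fun x y z => by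
    rw [hswap z x, map_neg, h₀₂, neg_zero]
  have h₁₂ : ∀ x y z, B (φ y x) (φ x z) = 0 := fun x y z => by
    rw [hBsymm, h₀₃]
  have h₁₃ : ∀ x y z, B (φ y x) (φ z x) = 0 := fun x y z => by
    rw [hswap z x, map_neg, h₁₂, neg_zero]
  have hacbd : B (φ a c) (φ b d) = -B (φ a b) (φ c d) := by
    rw [hT, hT, ← T.map_swap ![a, b, c, d] (i := 1) (j := 2) (by decide)]
    congr 1
    ext i
    fin_cases i <;> rfl
  have hcdab := hBsymm (φ c d) (φ a b)
  have hbdac := hBsymm (φ b d) (φ a c)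
  rw [hacbd] at hbdac
  set t := B (φ a b) (φ c d)
  have hpos : 0 < t * t := mul_self_pos.mpr ht
  refine not_pos_of_orthogonal_of_pos B hBpos
    (u := φ a b + t • φ c d) (v := φ a c - t • φ b d) ?_ ?_ ?_ ?_ <;>
  simp only [map_add, map_sub, map_smul, LinearMap.add_apply, LinearMap.sub_apply,
    LinearMap.smul_apply, smul_eq_mul, h₀₂, h₀₃, h₁₂, h₁₃, hacbd, hcdab, hbdac] <;>
  first
  | ring1
  | linarith
end

section
/- Let H and W be finite-dimensional real vector spaces, and let B be a nondegenerate symmetric bilinear form on W such that every subspace of W on which B is positive definite has dimension at most 1. Let φ : H × H → W be an alternating bilinear map, and let T : H × H × H × H → ℝ be an alternating multilinear form such that B(φ(a,b), φ(c,d)) = T(a,b,c,d) for all a, b, c, d ∈ H. Then the linear span of the image of φ has dimension at most 1; that is, there exists Σ ∈ W such that φ(a,b) ∈ ℝ·Σ for all a, b ∈ H. -/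
/-- A symmetric form whose positive definite subspaces are at most lines has no two orthogonal
positive vectors. -/
theorem false_of_orthogonal_positive_pair
    {W : Type*} [AddCommGroup W] [Module ℝ W]
    (B : W →ₗ[ℝ] W →ₗ[ℝ] ℝ) (hBsymm : ∀ x y, B x y = B y x)
    (hBpos : ∀ U : Submodule ℝ W, (∀ u ∈ U, u ≠ 0 → 0 < B u u) →
      Module.finrank ℝ U ≤ 1)
    {p q : W} (hp : 0 < B p p) (hq : 0 < B q q) (hpq : B p q = 0) : False := by
  have hqp : B q p = 0 := by rw [hBsymm, hpq]
  have hB (s t : ℝ) : B (s • p + t • q) (s • p + t • q) = s ^ 2 * B p p + t ^ 2 * B q q := by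
    simp [hpq, hqp]
    ring
  have hli : LinearIndependent ℝ ![p, q] := by
    rw [LinearIndependent.pair_iff]
    intro s t hst
    have h := hB s t
    rw [hst, map_zero] at h
    have hs : s ^ 2 * B p p = 0 := by nlinarith [sq_nonneg s, sq_nonneg t]
    have ht : t ^ 2 * B q q = 0 := by linarith
    simpa [hp.ne', hq.ne'] using And.intro hs ht
  have hle := hBpos (Submodule.span ℝ (Set.range ![p, q])) fun u hu hu0 => by
    rw [Matrix.range_cons_cons_empty, Submodule.mem_span_pair] at hu
    obtain ⟨s, t, rfl⟩ := hu
    rw [hB]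
    rcases eq_or_ne s 0 with rfl | hs
    · have ht : t ≠ 0 := by
        rintro rfl
        simp at hu0
      positivity
    · positivity
  rw [finrank_span_eq_card hli] at hle
  simp at hle

/-- For a nondegenerate symmetric form whose positive definite subspaces are at most lines,
totally isotropic subspaces are at most lines. -/
theorem exists_eq_smul_of_isotropic_pair
    {W : Type*} [AddCommGroup W] [Module ℝ W]
    (B : W →ₗ[ℝ] W →ₗ[ℝ] ℝ) (hBsymm : ∀ x y, B x y = B y x)
    (hBnondeg : ∀ x : W, (∀ y : W, B x y = 0) → x = 0)
    (hBpos : ∀ U : Submodule ℝ W, (∀ u ∈ U, u ≠ 0 → 0 < B u u) →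
      Module.finrank ℝ U ≤ 1)
    {x y : W} (hx : x ≠ 0) (hxx : B x x = 0) (hxy : B x y = 0) (hyy : B y y = 0) :
    ∃ r : ℝ, y = r • x := by
  have hdual {v : W} (hv : v ≠ 0) : ∃ z, B v z = 1 := by
    obtain ⟨z, hz⟩ := not_forall.mp (mt (hBnondeg v) hv)
    exact ⟨(B v z)⁻¹ • z, by simp [hz]⟩
  obtain ⟨z, hz⟩ := hdual hx
  refine ⟨B y z, ?_⟩
  by_contra hne
  set v := y - B y z • x with hv
  have hyx : B y x = 0 := by rw [hBsymm, hxy]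
  have hxv : B x v = 0 := by simp [hv, hxx, hxy]
  have hvx : B v x = 0 := by rw [hBsymm, hxv]
  have hvv : B v v = 0 := by simp [hv, hxx, hxy, hyx, hyy]
  have hvz : B v z = 0 := by simp [hv, hz]
  obtain ⟨w, hw⟩ := hdual (sub_ne_zero.mpr hne)
  rw [← hv] at hw
  obtain ⟨w', hxw', hzw', hvw'⟩ : ∃ w', B x w' = 0 ∧ B z w' = 0 ∧ B v w' = 1 := by
    refine ⟨w - B x w • z - (B z w - B x w * B z z) • x, ?_, ?_, ?_⟩
    · simp [hz, hxx]
    · simp [hBsymm z x, hz]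
    · simp [hvz, hvx, hw]
  refine false_of_orthogonal_positive_pair B hBsymm hBpos
    (p := ((1 - B z z) / 2) • x + z) (q := ((1 - B w' w') / 2) • v + w') ?_ ?_ ?_
  · simp only [map_add, map_smul, LinearMap.add_apply, LinearMap.smul_apply, smul_eq_mul,
      hBsymm z x, hz, hxx]
    linarith
  · simp only [map_add, map_smul, LinearMap.add_apply, LinearMap.smul_apply, smul_eq_mul,
      hBsymm w' v, hvw', hvv]
    linarith
  · simp [hxv, hxw', hzw', hBsymm z v, hvz]

/-- If `B (φ a b) (φ c d)` is alternating in all four arguments and the positive definite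
subspaces of `B` are at most lines, then these pairings all vanish. -/
theorem pairing_eq_zero_of_alternating
    {H W : Type*} [AddCommGroup H] [Module ℝ H] [AddCommGroup W] [Module ℝ W]
    (B : W →ₗ[ℝ] W →ₗ[ℝ] ℝ) (hBsymm : ∀ x y, B x y = B y x)
    (hBpos : ∀ U : Submodule ℝ W, (∀ u ∈ U, u ≠ 0 → 0 < B u u) →
      Module.finrank ℝ U ≤ 1)
    (φ : H →ₗ[ℝ] H →ₗ[ℝ] W) (T : H [⋀^Fin 4]→ₗ[ℝ] ℝ)
    (hT : ∀ a b c d : H, B (φ a b) (φ c d) = T ![a, b, c, d]) (a b c d : H) :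
    B (φ a b) (φ c d) = 0 := by
  have h02 (a b d : H) : B (φ a b) (φ a d) = 0 := by
    rw [hT]
    exact T.map_eq_zero_of_eq _ (i := 0) (j := 2) rfl (by decide)
  have h13 (a b c : H) : B (φ a b) (φ c b) = 0 := by
    rw [hT]
    exact T.map_eq_zero_of_eq _ (i := 1) (j := 3) rfl (by decide)
  have h03 (a b c : H) : B (φ a b) (φ c a) = 0 := by
    rw [hT]
    exact T.map_eq_zero_of_eq _ (i := 0) (j := 3) rfl (by decide)
  have h12 (a b d : H) : B (φ a b) (φ b d) = 0 := by
    rw [hT]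
    exact T.map_eq_zero_of_eq _ (i := 1) (j := 2) rfl (by decide)
  have hswap : B (φ a c) (φ b d) = -B (φ a b) (φ c d) := by
    have h := h12 a (b + c) d
    simp only [map_add, LinearMap.add_apply, h12] at h
    linarith
  by_contra ht
  set t := B (φ a b) (φ c d) with htdef
  have hcd : B (φ c d) (φ a b) = t := hBsymm _ _
  have hbd : B (φ b d) (φ a c) = -t := by rw [hBsymm, hswap]
  refine false_of_orthogonal_positive_pair B hBsymm hBpos
    (p := φ a b + t • φ c d) (q := φ a c - t • φ b d) ?_ ?_ ?_
  · simp only [map_add, map_smul, LinearMap.add_apply, LinearMap.smul_apply, smul_eq_mul,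
      h02, hcd, ← htdef]
    nlinarith [sq_pos_of_ne_zero ht]
  · simp only [map_sub, map_smul, LinearMap.sub_apply, LinearMap.smul_apply, smul_eq_mul,
      h02, hswap, hbd]
    nlinarith [sq_pos_of_ne_zero ht]
  · simp [h02, h12, h03, h13]


/-- For a closed 4-manifold with `b⁺ = 1` (abstracted: `B` is a nondegenerate
symmetric bilinear form on `W` whose positive definite subspaces have dimension
at most 1), the image of an alternating bilinear map `φ : H × H → W` whose
`B`-pairings are given by an alternating 4-form `T` spans a line: there is a
class `Σ` with `φ a b ∈ ℝ • Σ` for all `a b`. -/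
theorem image_of_wedge_is_a_line
    {H W : Type*} [AddCommGroup H] [Module ℝ H] [FiniteDimensional ℝ H]
    [AddCommGroup W] [Module ℝ W] [FiniteDimensional ℝ W]
    (B : W →ₗ[ℝ] W →ₗ[ℝ] ℝ) (hBsymm : ∀ x y, B x y = B y x)
    (hBnondeg : ∀ x : W, (∀ y : W, B x y = 0) → x = 0)
    (hBpos : ∀ U : Submodule ℝ W, (∀ u ∈ U, u ≠ 0 → 0 < B u u) →
      Module.finrank ℝ U ≤ 1)
    (φ : H →ₗ[ℝ] H →ₗ[ℝ] W) (hφ : ∀ a, φ a a = 0)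
    (T : H [⋀^Fin 4]→ₗ[ℝ] ℝ)
    (hT : ∀ a b c d : H, B (φ a b) (φ c d) = T ![a, b, c, d]) :
    ∃ Sig : W, ∀ a b : H, ∃ r : ℝ, φ a b = r • Sig := by
  have hiso := pairing_eq_zero_of_alternating B hBsymm hBpos φ T hT
  by_cases h0 : ∀ a b, φ a b = 0
  · exact ⟨0, fun a b => ⟨0, by simp [h0]⟩⟩
  push Not at h0
  obtain ⟨a₀, b₀, hne⟩ := h0
  exact ⟨φ a₀ b₀, fun a b => exists_eq_smul_of_isotropic_pair B hBsymm hBnondeg hBpos hne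
    (hiso _ _ _ _) (hiso _ _ _ _) (hiso _ _ _ _)⟩
end

section
/- Let R be a commutative ℚ-algebra and a : ℕ → R a sequence. For n ≥ 1 define c_n = (1/n!)·det C_n, where C_n is the n×n matrix with entries (C_n)_{ij} = a_{i−j+1} for j ≤ i, (C_n)_{i,i+1} = n − i, and 0 otherwise; and define s_n = (1/n!)·det S_n, where S_n is the n×n matrix with entries (S_n)_{ij} = (−1)^{i−j+1} a_{i−j+1} for j ≤ i, (S_n)_{i,i+1} = −(n − i), and 0 otherwise. Set c₀ = s₀ = 1. Then for every n ≥ 1, ∑_{i=0}^{n} c_i · s_{n−i} = 0; equivalently, the formal power series ∑_{n≥0} c_n tⁿ and ∑_{n≥0} s_n tⁿ are mutually inverse in R[[t]]. -/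
/-- The lower Hessenberg matrix with first column `v`, the other columns given on and below the
diagonal by the Toeplitz entries `b (i - j + 1)`, and superdiagonal
`(n - 1) x, (n - 2) x, …, x`. -/
def weightedHessenberg {R : Type*} [CommRing R] (b v : ℕ → R) (x : R) (n : ℕ) :
    Matrix (Fin n) (Fin n) R :=
  Matrix.of fun i j =>
    if (j : ℕ) = 0 then v i
    else if (j : ℕ) ≤ (i : ℕ) then b ((i : ℕ) - (j : ℕ) + 1)
    else if (j : ℕ) = (i : ℕ) + 1 then x * ((n - 1 - (i : ℕ) : ℕ) : R)
    else 0

namespace weightedHessenberg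

variable {R : Type*} [CommRing R]

theorem det_one (b v : ℕ → R) (x : R) : (weightedHessenberg b v x 1).det = v 0 := by
  simp [weightedHessenberg]

theorem det_add_two (b v : ℕ → R) (x : R) (m : ℕ) :
    (weightedHessenberg b v x (m + 2)).det =
      v 0 * (weightedHessenberg b (fun k => b (k + 1)) x (m + 1)).det -
        x * (m + 1) * (weightedHessenberg b (fun k => v (k + 1)) x (m + 1)).det := by
  have minor_zero : (weightedHessenberg b v x (m + 2)).submatrix Fin.succ (Fin.succAbove 0) =
      weightedHessenberg b (fun k => b (k + 1)) x (m + 1) := by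
    ext i j
    simp only [weightedHessenberg, Matrix.submatrix_apply, Matrix.of_apply, Fin.succAbove_zero,
      Fin.val_succ]
    have hsub : m + 2 - 1 - ((i : ℕ) + 1) = m + 1 - 1 - i := by omega
    rw [hsub]
    by_cases hj : (j : ℕ) = 0 <;> simp [hj]
  have minor_one :
      (weightedHessenberg b v x (m + 2)).submatrix Fin.succ (Fin.succAbove (Fin.succ 0)) =
        weightedHessenberg b (fun k => v (k + 1)) x (m + 1) := by
    ext i j
    have hsub : m + 2 - 1 - ((i : ℕ) + 1) = m + 1 - 1 - i := by omega
    refine Fin.cases ?_ (fun j => ?_) j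
    · simp [weightedHessenberg]
    · simp only [weightedHessenberg, Matrix.submatrix_apply, Matrix.of_apply,
        Fin.succ_succAbove_succ, Fin.succAbove_zero, Fin.val_succ, hsub]
      simp
  rw [Matrix.det_succ_row_zero, Fin.sum_univ_succ, Fin.sum_univ_succ, minor_zero, minor_one,
    Finset.sum_eq_zero]
  · simp [weightedHessenberg]
    ring
  · intro j _
    simp [weightedHessenberg]

theorem det_succ (b d : ℕ → R) (x : R) (hd0 : d 0 = 1)
    (hd : ∀ n, (weightedHessenberg b (fun k => b (k + 1)) x (n + 1)).det =
      (n + 1).factorial * d (n + 1)) (m : ℕ) (v : ℕ → R) :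
    (weightedHessenberg b v x (m + 1)).det =
      m.factorial * ∑ k ∈ Finset.range (m + 1), (-x) ^ k * v k * d (m - k) := by
  induction m generalizing v with
  | zero => rw [zero_add, det_one]; simp [hd0]
  | succ m ih =>
    rw [det_add_two, hd, ih, Finset.sum_range_succ' _ (m + 1), Nat.factorial_succ]
    simp only [Nat.add_sub_add_right, pow_succ, Finset.mul_sum, mul_add]
    push_cast
    rw [sub_eq_add_neg, add_comm, ← Finset.sum_neg_distrib]
    congr 1
    · exact Finset.sum_congr rfl fun k _ => by ring
    · simp
      ring

variable [Algebra ℚ R]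

/-- Newton-type identity, as a differential equation for the generating function of the
normalised determinants. -/
theorem derivative_mk (b d : ℕ → R) (x : R) (hd0 : d 0 = 1)
    (hd : ∀ n, 1 ≤ n → d n = (n.factorial : ℚ)⁻¹ •
      (weightedHessenberg b (fun k => b (k + 1)) x n).det) :
    PowerSeries.derivative R (PowerSeries.mk d) =
      PowerSeries.mk (fun k => (-x) ^ k * b (k + 1)) * PowerSeries.mk d := by
  have hdet (n : ℕ) : (weightedHessenberg b (fun k => b (k + 1)) x (n + 1)).det =
      (n + 1).factorial * d (n + 1) := by
    have h : ((n + 1).factorial : ℚ) ≠ 0 := by positivity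
    rw [hd _ n.succ_pos, ← nsmul_eq_mul, ← Nat.cast_smul_eq_nsmul ℚ, smul_inv_smul₀ h]
  ext n
  have key := (hdet n).symm.trans (det_succ b d x hd0 hdet n _)
  have hunit : IsUnit (n.factorial : R) := by
    have h : IsUnit (n.factorial : ℚ) := (Nat.cast_ne_zero.mpr n.factorial_ne_zero).isUnit
    simpa using h.map (algebraMap ℚ R)
  rw [PowerSeries.coeff_derivative, PowerSeries.coeff_mul,
    Finset.Nat.sum_antidiagonal_eq_sum_range_succ_mk]
  simp only [PowerSeries.coeff_mk]
  refine hunit.mul_left_cancel ?_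
  rw [← key, Nat.factorial_succ]
  push_cast
  ring

end weightedHessenberg

/-- The paper's Proposition on Segre classes: if `cₙ = (1/n!) det Cₙ` and
`sₙ = (1/n!) det Sₙ` are defined by the two displayed determinants in the
quantities `aᵢ` (with `c₀ = s₀ = 1`), then `∑_{i=0}^n cᵢ s_{n-i} = 0` for all
`n ≥ 1`; equivalently, the power series `∑ cₙ tⁿ` and `∑ sₙ tⁿ` are mutually
inverse. -/
theorem chern_segre_determinants_inverse
    {R : Type*} [CommRing R] [Algebra ℚ R]
    (a c s : ℕ → R) (hc0 : c 0 = 1) (hs0 : s 0 = 1)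
    (hc : ∀ n : ℕ, 1 ≤ n → c n = (n.factorial : ℚ)⁻¹ •
      Matrix.det (Matrix.of fun i j : Fin n =>
        if (j : ℕ) ≤ (i : ℕ) then a ((i : ℕ) - (j : ℕ) + 1)
        else if (j : ℕ) = (i : ℕ) + 1 then ((n - 1 - (i : ℕ) : ℕ) : R)
        else 0))
    (hs : ∀ n : ℕ, 1 ≤ n → s n = (n.factorial : ℚ)⁻¹ •
      Matrix.det (Matrix.of fun i j : Fin n =>
        if (j : ℕ) ≤ (i : ℕ) then
          (-1 : R) ^ ((i : ℕ) - (j : ℕ) + 1) * a ((i : ℕ) - (j : ℕ) + 1)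
        else if (j : ℕ) = (i : ℕ) + 1 then -((n - 1 - (i : ℕ) : ℕ) : R)
        else 0)) :
    (∀ n : ℕ, 1 ≤ n → ∑ i ∈ Finset.range (n + 1), c i * s (n - i) = 0) ∧
      (PowerSeries.mk c) * (PowerSeries.mk s) = 1 := by
  have hC : PowerSeries.derivative R (PowerSeries.mk c) =
      PowerSeries.mk (fun k => (-1) ^ k * a (k + 1)) * PowerSeries.mk c := by
    refine weightedHessenberg.derivative_mk a c 1 hc0 fun n hn => ?_
    rw [hc n hn]
    congr 2
    ext i j
    by_cases hj : (j : ℕ) = 0 <;> simp [weightedHessenberg, hj, -Fin.val_fin_le]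
  have hS : PowerSeries.derivative R (PowerSeries.mk s) =
      -PowerSeries.mk (fun k => (-1) ^ k * a (k + 1)) * PowerSeries.mk s := by
    have h := weightedHessenberg.derivative_mk (fun k => (-1) ^ k * a k) s (-1) hs0 fun n hn => by
      rw [hs n hn]
      congr 2
      ext i j
      by_cases hj : (j : ℕ) = 0 <;> simp [weightedHessenberg, hj, -Fin.val_fin_le]
    rw [h]
    congr 1
    ext k
    simp [pow_succ]
  have hmul : PowerSeries.mk c * PowerSeries.mk s = 1 := by
    have := IsAddTorsionFree.of_module_rat R
    refine PowerSeries.derivative.ext ?_ ?_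
    · rw [Derivation.leibniz, hC, hS, Derivation.map_one_eq_zero, smul_eq_mul, smul_eq_mul]
      ring
    · simp [← PowerSeries.coeff_zero_eq_constantCoeff_apply, PowerSeries.coeff_mul, hc0, hs0]
  refine ⟨fun n hn => ?_, hmul⟩
  have h := congrArg (PowerSeries.coeff n) hmul
  rw [PowerSeries.coeff_mul, Finset.Nat.sum_antidiagonal_eq_sum_range_succ_mk] at h
  simpa [PowerSeries.coeff_one, Nat.one_le_iff_ne_zero.mp hn] using h
end
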